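/- Let μ be a signed Radon measure on ℝ² supported in the closed unit disk with 0 < |μ|(ℝ²) < +∞, and let I_μ(x) = −(1/2π)∫_{ℝ²} log|x−y| dμ(y). Then I_μ ∈ W^{1,q}_loc(ℝ²) for every q ∈ [1,2), I_μ weakly solves −ΔI_μ = μ, and there is a constant C(q) depending only on q such that r^{q−2} ∫_{D_r(x)} |∇I_μ|^q dx ≤ C(q)·(|μ|(ℝ²))^q for every x ∈ ℝ² and every r > 0. -/

import Mathlib

open MeasureTheory Metric Set Filter
open scoped Topology ENNReal NNReal BigOperators

noncomputable section

abbrev E2 : Type := EuclideanSpace ℝ (Fin 2)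

/-- Smooth compactly supported test function. -/
def IsTest (φ : E2 → ℝ) : Prop := ContDiff ℝ (⊤ : ℕ∞) φ ∧ HasCompactSupport φ

/-- Euclidean Laplacian. -/
def lap (φ : E2 → ℝ) (x : E2) : ℝ :=
  ∑ i : Fin 2, fderiv ℝ (fun y => fderiv ℝ φ y (EuclideanSpace.single i (1:ℝ))) x
    (EuclideanSpace.single i (1:ℝ))

/-- Integral of a function against a signed measure. -/
def sInt (μ : SignedMeasure E2) (f : E2 → ℝ) : ℝ :=
  (∫ x, f x ∂μ.toJordanDecomposition.posPart) - ∫ x, f x ∂μ.toJordanDecomposition.negPart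

/-- Total variation measure of a signed measure. -/
def tv (μ : SignedMeasure E2) : Measure E2 := μ.totalVariation

/-- `u` weakly solves `-Δ u = μ` on `Ω`. -/
def WeakPoisson (Ω : Set E2) (u : E2 → ℝ) (μ : SignedMeasure E2) : Prop :=
  ∀ φ : E2 → ℝ, IsTest φ → tsupport φ ⊆ Ω →
    (∫ x in Ω, u x * lap φ x) = - sInt μ φ

/-- `du` is the weak gradient of `u` on `Ω`. -/
def IsWeakGrad (Ω : Set E2) (u : E2 → ℝ) (du : E2 → E2) : Prop :=
  ∀ φ : E2 → ℝ, IsTest φ → tsupport φ ⊆ Ω → ∀ i : Fin 2,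
    (∫ x in Ω, u x * fderiv ℝ φ x (EuclideanSpace.single i (1:ℝ)))
      = - ∫ x in Ω, φ x * du x i

/-- Piecewise C¹ curve on `[0,1]`. -/
def PiecewiseC1 (γ : ℝ → E2) : Prop :=
  ContinuousOn γ (Set.Icc 0 1) ∧
  ∃ (n : ℕ) (t : Fin (n + 1) → ℝ), StrictMono t ∧ t 0 = 0 ∧ t (Fin.last n) = 1 ∧
    ∀ i : Fin n, ContDiffOn ℝ 1 γ (Set.Icc (t i.castSucc) (t i.succ))

/-- Length of a curve in the conformal metric `e^{2u} g_euc`. -/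
def clen (u : E2 → ℝ) (γ : ℝ → E2) : ℝ :=
  ∫ t in (0:ℝ)..1, Real.exp (u (γ t)) * ‖deriv γ t‖

/-- Piecewise C¹ curves in `Ω` from `x` to `y`. -/
def pathsIn (Ω : Set E2) (x y : E2) : Set (ℝ → E2) :=
  {γ | PiecewiseC1 γ ∧ γ 0 = x ∧ γ 1 = y ∧ ∀ t ∈ Set.Icc (0:ℝ) 1, γ t ∈ Ω}

/-- The distance of the conformal metric `e^{2u} g_euc` on `Ω`. -/
def gdist (u : E2 → ℝ) (Ω : Set E2) (x y : E2) : ℝ :=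
  sInf (clen u '' pathsIn Ω x y)



lemma lintegral_inv_norm_rpow_ball_zero {q : ℝ} (hq : q < 2) {r : ℝ} (hr : 0 < r) :
    ∫⁻ z in ball (0 : E2) r, ENNReal.ofReal (‖z‖⁻¹ ^ q)
      = ENNReal.ofReal (2 * Real.pi / (2 - q) * r ^ (2 - q)) := by
  have hint : IntegrableOn (fun y : ℝ => y ^ (1 - q)) (Ioo 0 r) :=
    ((intervalIntegral.intervalIntegrable_rpow' (by linarith : -1 < 1 - q)
      (a := 0) (b := r)).1).mono_set Ioo_subset_Ioc_self
  have hcongr : ∀ y ∈ Ioo (0:ℝ) r, y ^ (1 - q) = y ^ (Module.finrank ℝ E2 - 1) • y⁻¹ ^ q := by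
    intro y hy
    rw [Real.inv_rpow hy.1.le, ← Real.rpow_neg hy.1.le, sub_eq_add_neg, Real.rpow_add hy.1]
    simp
  have hI : IntegrableOn (fun z : E2 => ‖z‖⁻¹ ^ q) (ball 0 r) := by
    rw [integrableOn_fun_norm_addHaar volume (f := fun t : ℝ => t⁻¹ ^ q)]
    exact hint.congr_fun hcongr measurableSet_Ioo
  rw [← ofReal_integral_eq_lintegral_ofReal hI (ae_of_all _ fun z => by positivity)]
  congr 1
  have h1 : ∫ z in ball (0 : E2) r, ‖z‖⁻¹ ^ q
      = ∫ z : E2, (Iio r).indicator (fun t : ℝ => t⁻¹ ^ q) ‖z‖ := by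
    rw [← integral_indicator measurableSet_ball]
    congr 1
    ext z
    simp [indicator]
  rw [h1, integral_fun_norm_addHaar]
  have h2 : ∫ y in Ioi (0 : ℝ), y ^ (Module.finrank ℝ E2 - 1) •
      (Iio r).indicator (fun t : ℝ => t⁻¹ ^ q) y = ∫ y in Ioo (0:ℝ) r, y ^ (1 - q) := by
    rw [setIntegral_congr_fun measurableSet_Ioo hcongr, ← Ioi_inter_Iio,
      ← setIntegral_indicator measurableSet_Iio]
    congr 1
    ext y
    by_cases h : y < r <;> simp [h]
  rw [h2, ← integral_Ioc_eq_integral_Ioo, ← intervalIntegral.integral_of_le hr.le,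
    integral_rpow (Or.inl (by linarith))]
  have h3 : (volume : Measure E2).real (ball 0 1) = Real.pi := by
    simp [Measure.real, EuclideanSpace.volume_ball_fin_two, Real.pi_pos.le]
  rw [h3]
  have : 1 - q + 1 = 2 - q := by ring
  rw [this, Real.zero_rpow (by linarith)]
  simp
  ring

lemma lintegral_inv_norm_sub_rpow_ball_le {q : ℝ} (hq0 : 0 ≤ q) (hq : q < 2) (x y : E2) {r : ℝ}
    (hr : 0 < r) :
    ∫⁻ z in ball x r, ENNReal.ofReal (‖z - y‖⁻¹ ^ q)
      ≤ ENNReal.ofReal ((2 * Real.pi / (2 - q) + Real.pi) * r ^ (2 - q)) := by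
  have hsub : ball x r ⊆ ball y r ∪ (ball x r \ ball y r) := by
    intro z hz
    by_cases h : z ∈ ball y r
    · exact Or.inl h
    · exact Or.inr ⟨hz, h⟩
  have h1 : ∫⁻ z in ball y r, ENNReal.ofReal (‖z - y‖⁻¹ ^ q)
      = ENNReal.ofReal (2 * Real.pi / (2 - q) * r ^ (2 - q)) := by
    rw [← lintegral_inv_norm_rpow_ball_zero hq hr, ← lintegral_indicator measurableSet_ball,
      ← lintegral_indicator measurableSet_ball,
      ← lintegral_sub_right_eq_self (fun z : E2 => (ball (0:E2) r).indicator _ z) y]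
    congr 1
    ext z
    simp [indicator, dist_eq_norm]
  have h2 : ∫⁻ z in ball x r \ ball y r, ENNReal.ofReal (‖z - y‖⁻¹ ^ q)
      ≤ ENNReal.ofReal (Real.pi * r ^ (2 - q)) := by
    calc _ ≤ ∫⁻ z in ball x r \ ball y r, ENNReal.ofReal (r⁻¹ ^ q) := by
          refine setLIntegral_mono' (measurableSet_ball.diff measurableSet_ball) fun z hz => ?_
          have : r ≤ ‖z - y‖ := by
            have := hz.2
            rwa [mem_ball, not_lt, dist_eq_norm] at this
          gcongr
      _ ≤ ENNReal.ofReal (r⁻¹ ^ q) * volume (ball x r) := by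
          rw [setLIntegral_const]
          gcongr
          exact sdiff_subset
      _ = ENNReal.ofReal (Real.pi * r ^ (2 - q)) := by
          rw [EuclideanSpace.volume_ball_fin_two, ← ENNReal.ofReal_pow hr.le,
            ← ENNReal.ofReal_mul (by positivity), ← ENNReal.ofReal_mul (by positivity)]
          congr 1
          rw [Real.inv_rpow hr.le, Real.rpow_sub hr]
          norm_num
          field_simp
  calc _ ≤ _ := lintegral_mono_set hsub
    _ ≤ _ := lintegral_union_le _ _ _
    _ ≤ _ := add_le_add h1.le h2
    _ = _ := by
      have : 0 < 2 - q := by linarith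
      rw [← ENNReal.ofReal_add (by positivity) (by positivity), add_mul]

lemma abs_log_rpow_le {t q : ℝ} (ht : 0 ≤ t) (hq : 0 ≤ q) :
    |Real.log t| ^ q ≤ t ^ q + t⁻¹ ^ q := by
  rcases le_total 1 t with h | h
  · have : |Real.log t| ≤ t := by
      rw [abs_of_nonneg (Real.log_nonneg h)]
      exact (Real.log_le_sub_one_of_pos (by linarith)).trans (by linarith)
    have := Real.rpow_le_rpow (abs_nonneg _) this hq
    have : 0 ≤ t⁻¹ ^ q := by positivity
    linarith
  · have : |Real.log t| ≤ t⁻¹ := by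
      rcases ht.eq_or_lt with rfl | h0
      · simp
      rw [← abs_neg, ← Real.log_inv, abs_of_nonneg (Real.log_nonneg ((one_le_inv₀ h0).2 h))]
      exact (Real.log_le_sub_one_of_pos (by positivity)).trans (by linarith)
    have := Real.rpow_le_rpow (abs_nonneg _) this hq
    have : 0 ≤ t ^ q := by positivity
    linarith

lemma lintegral_abs_log_rpow_ball_le {q : ℝ} (hq0 : 0 ≤ q) (hq : q < 2) {r : ℝ} (hr : 0 < r) :
    ∃ C : ℝ≥0∞, C ≠ ∞ ∧ ∀ y ∈ closedBall (0 : E2) 1,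
      ∫⁻ z in ball (0 : E2) r, ENNReal.ofReal (|Real.log ‖z - y‖| ^ q) ≤ C := by
  refine ⟨ENNReal.ofReal ((r + 1) ^ q) * volume (ball (0:E2) r) +
    ENNReal.ofReal ((2 * Real.pi / (2 - q) + Real.pi) * r ^ (2 - q)), ?_, fun y hy => ?_⟩
  · exact ENNReal.add_ne_top.2 ⟨ENNReal.mul_ne_top ENNReal.ofReal_ne_top measure_ball_lt_top.ne,
      ENNReal.ofReal_ne_top⟩
  calc _ ≤ ∫⁻ z in ball (0 : E2) r, (ENNReal.ofReal ((r + 1) ^ q) +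
          ENNReal.ofReal (‖z - y‖⁻¹ ^ q)) := by
        refine setLIntegral_mono' measurableSet_ball fun z hz => ?_
        rw [← ENNReal.ofReal_add (by positivity) (by positivity)]
        refine ENNReal.ofReal_le_ofReal ((abs_log_rpow_le (norm_nonneg _) hq0).trans ?_)
        have : ‖z - y‖ ≤ r + 1 := (norm_sub_le _ _).trans
          (add_le_add (mem_ball_zero_iff.1 hz).le (mem_closedBall_zero_iff.1 hy))
        gcongr
    _ ≤ _ := by
        rw [lintegral_add_left measurable_const, setLIntegral_const]
        gcongr
        exact lintegral_inv_norm_sub_rpow_ball_le hq0 hq 0 y hr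

lemma IsTest.fderiv_apply {φ : E2 → ℝ} (hφ : IsTest φ) (v : E2) :
    IsTest (fun x => fderiv ℝ φ x v) :=
  ⟨(hφ.1.fderiv_right (m := (⊤ : ℕ∞)) (by simp)).clm_apply contDiff_const,
    hφ.2.fderiv_apply (𝕜 := ℝ) v⟩

lemma IsTest.comp_add_right {φ : E2 → ℝ} (hφ : IsTest φ) (y : E2) :
    IsTest (fun x => φ (x + y)) :=
  ⟨hφ.1.comp (contDiff_id.add contDiff_const),
    hφ.2.comp_homeomorph (Homeomorph.addRight y)⟩

lemma IsTest.add {φ ψ : E2 → ℝ} (hφ : IsTest φ) (hψ : IsTest ψ) :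
    IsTest (fun x => φ x + ψ x) :=
  ⟨hφ.1.add hψ.1, hφ.2.add hψ.2⟩

lemma IsTest.continuous {φ : E2 → ℝ} (hφ : IsTest φ) : Continuous φ := hφ.1.continuous

lemma IsTest.lap {φ : E2 → ℝ} (hφ : IsTest φ) : IsTest (lap φ) := by
  have := ((hφ.fderiv_apply (EuclideanSpace.single 0 1)).fderiv_apply
    (EuclideanSpace.single 0 1)).add ((hφ.fderiv_apply (EuclideanSpace.single 1 1)).fderiv_apply
    (EuclideanSpace.single 1 1))
  convert this using 1
  ext x
  simp [_root_.lap]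

lemma integral_mul_fderiv_of_isTest {f φ : E2 → ℝ} (hf : ContDiff ℝ 1 f) (hφ : IsTest φ) (v : E2) :
    ∫ x, f x * fderiv ℝ φ x v = -∫ x, fderiv ℝ f x v * φ x := by
  have hf' : Continuous fun x => fderiv ℝ f x v :=
    (hf.continuous_fderiv (by simp)).clm_apply continuous_const
  refine integral_mul_fderiv_eq_neg_fderiv_mul_of_integrable ?_ ?_ ?_
    (fun x _ => (hf.differentiable (by simp)).differentiableAt)
    (fun x _ => (hφ.1.differentiable (by simp)).differentiableAt)
  · exact (hf'.mul hφ.continuous).integrable_of_hasCompactSupport hφ.2.mul_left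
  · exact (hf.continuous.mul (hφ.fderiv_apply v).continuous).integrable_of_hasCompactSupport
      (hφ.fderiv_apply v).2.mul_left
  · exact (hf.continuous.mul hφ.continuous).integrable_of_hasCompactSupport hφ.2.mul_left

/-- The regularized logarithm `log √(‖x‖² + ε²)`. -/
def regLog (ε : ℝ) (x : E2) : ℝ := Real.log (‖x‖ ^ 2 + ε ^ 2) / 2

/-- The components of the gradient of the regularized logarithm. -/
def regGrad (ε : ℝ) (i : Fin 2) (x : E2) : ℝ := x i / (‖x‖ ^ 2 + ε ^ 2)

lemma contDiff_regLog {ε : ℝ} (hε : 0 < ε) : ContDiff ℝ 1 (regLog ε) :=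
  (((contDiff_norm_sq ℝ).add contDiff_const).log fun x => by positivity).div_const _

lemma contDiff_regGrad {ε : ℝ} (hε : 0 < ε) (i : Fin 2) : ContDiff ℝ 1 (regGrad ε i) := by
  unfold regGrad
  exact (contDiff_piLp_apply (i := i) (p := 2)).div ((contDiff_norm_sq ℝ).add contDiff_const)
    fun x => by positivity

lemma hasFDerivAt_norm_sq_add (ε : ℝ) (x : E2) :
    HasFDerivAt (fun x : E2 => ‖x‖ ^ 2 + ε ^ 2) (2 • innerSL ℝ x) x :=
  (hasStrictFDerivAt_norm_sq x).hasFDerivAt.add_const _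

lemma fderiv_regLog {ε : ℝ} (hε : 0 < ε) (i : Fin 2) (x : E2) :
    fderiv ℝ (regLog ε) x (EuclideanSpace.single i 1) = regGrad ε i x := by
  have h : HasFDerivAt (regLog ε) _ x :=
    ((hasFDerivAt_norm_sq_add ε x).log (by positivity)).mul_const (2⁻¹ : ℝ)
  rw [h.fderiv]
  simp [regGrad, EuclideanSpace.inner_single_right]
  field_simp

lemma fderiv_regGrad {ε : ℝ} (hε : 0 < ε) (i : Fin 2) (x : E2) :
    fderiv ℝ (regGrad ε i) x (EuclideanSpace.single i 1)
      = 1 / (‖x‖ ^ 2 + ε ^ 2) - 2 * (x i) ^ 2 / (‖x‖ ^ 2 + ε ^ 2) ^ 2 := by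
  have h1 : HasFDerivAt (fun x : E2 => x i) (EuclideanSpace.proj i : E2 →L[ℝ] ℝ) x :=
    (EuclideanSpace.proj i : E2 →L[ℝ] ℝ).hasFDerivAt
  have h : HasFDerivAt (regGrad ε i) _ x := h1.mul
    ((hasDerivAt_inv (by positivity : ‖x‖ ^ 2 + ε ^ 2 ≠ 0)).comp_hasFDerivAt x
      (hasFDerivAt_norm_sq_add ε x))
  rw [h.fderiv]
  simp [EuclideanSpace.inner_single_right]
  field_simp
  ring

lemma integral_regLog_mul_lap {ε : ℝ} (hε : 0 < ε) {φ : E2 → ℝ} (hφ : IsTest φ) :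
    ∫ x, regLog ε x * lap φ x = ∫ x, 2 * ε ^ 2 / (‖x‖ ^ 2 + ε ^ 2) ^ 2 * φ x := by
  have hint : ∀ i : Fin 2, Integrable fun x => regLog ε x *
      fderiv ℝ (fun y => fderiv ℝ φ y (EuclideanSpace.single i (1:ℝ))) x
        (EuclideanSpace.single i (1:ℝ)) := fun i =>
    ((contDiff_regLog hε).continuous.mul
      ((hφ.fderiv_apply _).fderiv_apply _).continuous).integrable_of_hasCompactSupport
      ((hφ.fderiv_apply _).fderiv_apply _).2.mul_left
  have hint' : ∀ i : Fin 2, Integrable fun x =>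
      fderiv ℝ (regGrad ε i) x (EuclideanSpace.single i 1) * φ x := fun i =>
    ((((contDiff_regGrad hε i).continuous_fderiv (by simp)).clm_apply continuous_const).mul
      hφ.continuous).integrable_of_hasCompactSupport hφ.2.mul_left
  have key : ∀ i : Fin 2, ∫ x, regLog ε x *
      fderiv ℝ (fun y => fderiv ℝ φ y (EuclideanSpace.single i (1:ℝ))) x
        (EuclideanSpace.single i (1:ℝ)) =
      ∫ x, fderiv ℝ (regGrad ε i) x (EuclideanSpace.single i 1) * φ x := fun i => by
    rw [integral_mul_fderiv_of_isTest (contDiff_regLog hε) (hφ.fderiv_apply _)]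
    simp_rw [fderiv_regLog hε]
    rw [integral_mul_fderiv_of_isTest (contDiff_regGrad hε i) hφ, neg_neg]
  simp only [lap, Finset.mul_sum]
  rw [integral_finsetSum _ fun i _ => hint i, Finset.sum_congr rfl fun i _ => key i,
    ← integral_finsetSum _ fun i _ => hint' i]
  congr 1
  ext x
  simp only [fderiv_regGrad hε, Fin.sum_univ_two]
  have : ‖x‖ ^ 2 = x 0 ^ 2 + x 1 ^ 2 := by
    rw [EuclideanSpace.norm_sq_eq]; simp
  have h0 : ‖x‖ ^ 2 + ε ^ 2 ≠ 0 := by positivity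
  rw [← add_mul]
  congr 1
  rw [div_sub_div _ _ h0 (by positivity), div_sub_div _ _ h0 (by positivity),
    div_add_div _ _ (by positivity) (by positivity), div_eq_div_iff (by positivity) (by positivity)]
  rw [this]
  ring

lemma integral_two_div_norm_sq_add_one_sq :
    Integrable (fun x : E2 => 2 / (‖x‖ ^ 2 + 1) ^ 2) ∧
      ∫ x : E2, 2 / (‖x‖ ^ 2 + 1) ^ 2 = 2 * Real.pi := by
  have hderiv : ∀ t ∈ Ici (0:ℝ), HasDerivAt (fun t : ℝ => -(t ^ 2 + 1)⁻¹)
      (t ^ (Module.finrank ℝ E2 - 1) • (2 / (t ^ 2 + 1) ^ 2)) t := fun t _ => by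
    have h0 : t ^ 2 + 1 ≠ 0 := by positivity
    have := (((hasDerivAt_pow 2 t).add_const (1:ℝ)).inv h0).neg
    refine this.congr_deriv ?_
    simp
    field_simp
  have hlim : Tendsto (fun t : ℝ => -(t ^ 2 + 1)⁻¹) atTop (𝓝 (-0)) :=
    (tendsto_inv_atTop_zero.comp
      (tendsto_atTop_add_const_right _ _ (tendsto_pow_atTop (by norm_num)))).neg
  have hpos : ∀ t ∈ Ioi (0:ℝ), 0 ≤ t ^ (Module.finrank ℝ E2 - 1) • (2 / (t ^ 2 + 1) ^ 2) :=
    fun t ht => by have : 0 < t := ht; positivity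
  refine ⟨?_, ?_⟩
  · rw [integrable_fun_norm_addHaar volume (f := fun t : ℝ => 2 / (t ^ 2 + 1) ^ 2)]
    exact integrableOn_Ioi_deriv_of_nonneg' hderiv hpos hlim
  · rw [integral_fun_norm_addHaar volume (fun t : ℝ => 2 / (t ^ 2 + 1) ^ 2),
      integral_Ioi_of_hasDerivAt_of_nonneg' hderiv hpos hlim]
    have h3 : (volume : Measure E2).real (ball 0 1) = Real.pi := by
      simp [Measure.real, EuclideanSpace.volume_ball_fin_two, Real.pi_pos.le]
    rw [h3]
    simp

lemma tendsto_integral_approx_identity {φ : E2 → ℝ} (hφ : IsTest φ) :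
    Tendsto (fun ε : ℝ => ∫ x, 2 * ε ^ 2 / (‖x‖ ^ 2 + ε ^ 2) ^ 2 * φ x) (𝓝[>] 0)
      (𝓝 (2 * Real.pi * φ 0)) := by
  obtain ⟨M, hM⟩ := hφ.2.exists_bound_of_continuous hφ.continuous
  have h1 : Tendsto (fun ε : ℝ => ∫ x : E2, 2 / (‖x‖ ^ 2 + 1) ^ 2 * φ (ε • x)) (𝓝[>] 0)
      (𝓝 (∫ x : E2, 2 / (‖x‖ ^ 2 + 1) ^ 2 * φ 0)) := by
    refine tendsto_integral_filter_of_dominated_convergence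
      (fun x : E2 => 2 / (‖x‖ ^ 2 + 1) ^ 2 * M) ?_ ?_
      (integral_two_div_norm_sq_add_one_sq.1.mul_const M) ?_
    · refine Eventually.of_forall fun ε => Continuous.aestronglyMeasurable ?_
      have := hφ.continuous
      fun_prop (disch := intros; positivity)
    · refine Eventually.of_forall fun ε => ae_of_all _ fun x => ?_
      rw [norm_mul, Real.norm_of_nonneg (by positivity : 0 ≤ 2 / (‖x‖ ^ 2 + 1) ^ 2)]
      gcongr
      exact hM _
    · refine ae_of_all _ fun x => (Tendsto.const_mul _ ?_)
      have : Tendsto (fun ε : ℝ => φ (ε • x)) (𝓝 0) (𝓝 (φ ((0:ℝ) • x))) :=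
        (hφ.continuous.comp (continuous_id.smul continuous_const)).tendsto 0
      rw [zero_smul] at this
      exact this.mono_left nhdsWithin_le_nhds
  rw [integral_mul_const, integral_two_div_norm_sq_add_one_sq.2] at h1
  refine h1.congr' ?_
  filter_upwards [self_mem_nhdsWithin] with ε hε
  have hε : 0 < ε := hε
  have := Measure.integral_comp_smul (volume : Measure E2)
    (fun x : E2 => 2 * ε ^ 4 / (‖x‖ ^ 2 + ε ^ 2) ^ 2 * φ x) ε
  have h2 : ∀ x : E2, 2 * ε ^ 4 / (‖ε • x‖ ^ 2 + ε ^ 2) ^ 2 * φ (ε • x)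
      = 2 / (‖x‖ ^ 2 + 1) ^ 2 * φ (ε • x) := fun x => by
    rw [norm_smul, Real.norm_of_nonneg hε.le]
    congr 1
    rw [div_eq_div_iff (by positivity) (by positivity)]
    ring
  simp_rw [h2] at this
  rw [this, smul_eq_mul, ← integral_const_mul]
  congr 1
  ext x
  simp [abs_of_pos hε]
  field_simp

lemma integrable_log_norm_mul {ψ : E2 → ℝ} (hψ : Continuous ψ) (hc : HasCompactSupport ψ) :
    Integrable (fun x => Real.log ‖x‖ * ψ x) := by
  obtain ⟨M, hM⟩ := hc.exists_bound_of_continuous hψ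
  obtain ⟨r, hr, hsub⟩ := hc.isCompact.isBounded.subset_ball_lt 0 0
  have h1 : IntegrableOn (fun x : E2 => Real.log ‖x‖ * ψ x) (ball 0 r) := by
    obtain ⟨C, hC, h⟩ := lintegral_abs_log_rpow_ball_le (q := 1) (by norm_num) (by norm_num) hr
    have h2 : IntegrableOn (fun x : E2 => Real.log ‖x‖) (ball 0 r) := by
      refine ⟨(Real.measurable_log.comp measurable_norm).aestronglyMeasurable, ?_⟩
      refine (lt_of_le_of_lt ?_ hC.lt_top)
      have := h 0 (by simp)
      simpa [Real.rpow_one, Real.enorm_eq_ofReal_abs] using this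
    exact h2.mul_bdd hψ.aestronglyMeasurable (ae_of_all _ hM)
  refine (integrableOn_iff_integrable_of_support_subset ?_).1 h1
  exact (Function.support_mul_subset_right _ _).trans ((subset_tsupport _).trans hsub)

lemma integrable_inv_norm_mul {ψ : E2 → ℝ} (hψ : Continuous ψ) (hc : HasCompactSupport ψ) :
    Integrable (fun x => ‖x‖⁻¹ * ψ x) := by
  obtain ⟨M, hM⟩ := hc.exists_bound_of_continuous hψ
  obtain ⟨r, hr, hsub⟩ := hc.isCompact.isBounded.subset_ball_lt 0 0
  have h1 : IntegrableOn (fun x : E2 => ‖x‖⁻¹ * ψ x) (ball 0 r) := by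
    have h := lintegral_inv_norm_sub_rpow_ball_le (q := 1) (by norm_num) (by norm_num) 0 0 hr
    have h2 : IntegrableOn (fun x : E2 => ‖x‖⁻¹) (ball 0 r) := by
      refine ⟨measurable_norm.inv.aestronglyMeasurable, ?_⟩
      refine (lt_of_le_of_lt ?_ (h.trans_lt ENNReal.ofReal_lt_top))
      simp [Real.rpow_one, Real.enorm_eq_ofReal_abs]
    exact h2.mul_bdd hψ.aestronglyMeasurable (ae_of_all _ hM)
  refine (integrableOn_iff_integrable_of_support_subset ?_).1 h1
  exact (Function.support_mul_subset_right _ _).trans ((subset_tsupport _).trans hsub)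

lemma tendsto_integral_regLog_mul {ψ : E2 → ℝ} (hψ : Continuous ψ) (hc : HasCompactSupport ψ) :
    Tendsto (fun ε : ℝ => ∫ x, regLog ε x * ψ x) (𝓝[>] 0) (𝓝 (∫ x, Real.log ‖x‖ * ψ x)) := by
  have hcont : Continuous fun x : E2 => Real.log (‖x‖ ^ 2 + 1) :=
    Continuous.log (by fun_prop) fun x => by positivity
  refine tendsto_integral_filter_of_dominated_convergence
    (fun x => |Real.log ‖x‖ * ψ x| + |Real.log (‖x‖ ^ 2 + 1) * ψ x|) ?_ ?_
    ((integrable_log_norm_mul hψ hc).abs.add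
      ((hcont.mul hψ).integrable_of_hasCompactSupport hc.mul_left).abs) ?_
  · filter_upwards [self_mem_nhdsWithin] with ε hε
    exact ((contDiff_regLog hε).continuous.mul hψ).aestronglyMeasurable
  · filter_upwards [Ioo_mem_nhdsGT (zero_lt_one : (0:ℝ) < 1)] with ε hε
    filter_upwards [Measure.ae_ne volume (0 : E2)] with x hx
    have hx : 0 < ‖x‖ := norm_pos_iff.2 hx
    rw [norm_mul, abs_mul, abs_mul, ← add_mul, Real.norm_eq_abs, Real.norm_eq_abs]
    gcongr
    have h1 : Real.log ‖x‖ ≤ regLog ε x := by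
      have : Real.log (‖x‖ ^ 2) ≤ Real.log (‖x‖ ^ 2 + ε ^ 2) :=
        Real.log_le_log (by positivity) (by nlinarith [hε.1])
      rw [Real.log_pow] at this
      unfold regLog
      push_cast at this
      linarith
    have h2 : regLog ε x ≤ Real.log (‖x‖ ^ 2 + 1) / 2 := by
      unfold regLog
      have := hε.1
      have : ε ^ 2 ≤ 1 := by nlinarith [hε.1, hε.2]
      gcongr
    have h3 : 0 ≤ Real.log (‖x‖ ^ 2 + 1) := Real.log_nonneg (by nlinarith)
    rw [abs_of_nonneg h3, abs_le]
    constructor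
    · linarith [neg_abs_le (Real.log ‖x‖)]
    · linarith [abs_nonneg (Real.log ‖x‖)]
  · filter_upwards [Measure.ae_ne volume (0 : E2)] with x hx
    have hx : 0 < ‖x‖ := norm_pos_iff.2 hx
    refine Tendsto.mul_const _ ?_
    have : ContinuousAt (fun ε : ℝ => Real.log (‖x‖ ^ 2 + ε ^ 2) / 2) 0 :=
      (ContinuousAt.log (by fun_prop) (by positivity)).div_const _
    have h := this.tendsto.mono_left (nhdsWithin_le_nhds (s := Ioi 0))
    have h0 : Real.log (‖x‖ ^ 2 + 0 ^ 2) / 2 = Real.log ‖x‖ := by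
      rw [zero_pow two_ne_zero, add_zero, Real.log_pow]
      push_cast
      ring
    rwa [h0] at h

lemma abs_regGrad_le (ε : ℝ) (i : Fin 2) (x : E2) : |regGrad ε i x| ≤ ‖x‖⁻¹ := by
  unfold regGrad
  rcases eq_or_ne x 0 with rfl | hx
  · simp
  have hx : 0 < ‖x‖ := norm_pos_iff.2 hx
  rw [abs_div, abs_of_nonneg (by positivity : 0 ≤ ‖x‖ ^ 2 + ε ^ 2), div_le_iff₀ (by positivity)]
  have : |x i| ≤ ‖x‖ := PiLp.norm_apply_le x i
  have h2 : ‖x‖⁻¹ * (‖x‖ ^ 2 + ε ^ 2) = ‖x‖ + ‖x‖⁻¹ * ε ^ 2 := by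
    field_simp
  rw [h2]
  have : 0 ≤ ‖x‖⁻¹ * ε ^ 2 := by positivity
  linarith

lemma tendsto_integral_regGrad_mul (i : Fin 2) {ψ : E2 → ℝ} (hψ : Continuous ψ)
    (hc : HasCompactSupport ψ) :
    Tendsto (fun ε : ℝ => ∫ x, regGrad ε i x * ψ x) (𝓝[>] 0)
      (𝓝 (∫ x, regGrad 0 i x * ψ x)) := by
  refine tendsto_integral_filter_of_dominated_convergence
    (fun x => |‖x‖⁻¹ * ψ x|) ?_ ?_ (integrable_inv_norm_mul hψ hc).abs ?_
  · filter_upwards [self_mem_nhdsWithin] with ε hε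
    exact ((contDiff_regGrad hε i).continuous.mul hψ).aestronglyMeasurable
  · refine Eventually.of_forall fun ε => ae_of_all _ fun x => ?_
    rw [norm_mul, abs_mul, Real.norm_eq_abs, Real.norm_eq_abs, abs_of_nonneg (by positivity :
      0 ≤ ‖x‖⁻¹)]
    gcongr
    exact abs_regGrad_le ε i x
  · filter_upwards [Measure.ae_ne volume (0 : E2)] with x hx
    have hx : 0 < ‖x‖ := norm_pos_iff.2 hx
    refine Tendsto.mul_const _ ?_
    have : ContinuousAt (fun ε : ℝ => x i / (‖x‖ ^ 2 + ε ^ 2)) 0 :=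
      continuousAt_const.div (by fun_prop) (by positivity)
    exact this.tendsto.mono_left nhdsWithin_le_nhds

/-- The weak gradient of `log ‖x - y‖`. -/
lemma integral_log_norm_sub_mul_fderiv {φ : E2 → ℝ} (hφ : IsTest φ) (y : E2) (i : Fin 2) :
    ∫ x, Real.log ‖x - y‖ * fderiv ℝ φ x (EuclideanSpace.single i 1)
      = -∫ x, regGrad 0 i (x - y) * φ x := by
  have key : ∀ φ : E2 → ℝ, IsTest φ →
      ∫ x, Real.log ‖x‖ * fderiv ℝ φ x (EuclideanSpace.single i 1)
        = -∫ x, regGrad 0 i x * φ x := fun φ hφ => by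
    have h' := hφ.fderiv_apply (EuclideanSpace.single i 1)
    refine tendsto_nhds_unique (tendsto_integral_regLog_mul h'.continuous h'.2)
      ((tendsto_integral_regGrad_mul i hφ.continuous hφ.2).neg.congr' ?_)
    filter_upwards [self_mem_nhdsWithin] with ε hε
    rw [integral_mul_fderiv_of_isTest (contDiff_regLog hε) hφ]
    simp_rw [fderiv_regLog hε]
  rw [← integral_add_right_eq_self _ y, ← integral_add_right_eq_self
    (fun x => regGrad 0 i (x - y) * φ x) y]
  simp only [add_sub_cancel_right]
  rw [← key _ (hφ.comp_add_right y)]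
  simp_rw [fderiv_comp_add_right]

/-- `log ‖x - y‖ / 2π` is a fundamental solution of the Laplacian. -/
lemma integral_log_norm_sub_mul_lap {φ : E2 → ℝ} (hφ : IsTest φ) (y : E2) :
    ∫ x, Real.log ‖x - y‖ * lap φ x = 2 * Real.pi * φ y := by
  have key : ∀ φ : E2 → ℝ, IsTest φ →
      ∫ x, Real.log ‖x‖ * lap φ x = 2 * Real.pi * φ 0 := fun φ hφ => by
    refine tendsto_nhds_unique (tendsto_integral_regLog_mul hφ.lap.continuous hφ.lap.2)
      ((tendsto_integral_approx_identity hφ).congr' ?_)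
    filter_upwards [self_mem_nhdsWithin] with ε hε
    rw [integral_regLog_mul_lap hε hφ]
  rw [← integral_add_right_eq_self _ y]
  simp only [add_sub_cancel_right]
  have := key _ (hφ.comp_add_right y)
  rw [zero_add] at this
  rw [← this]
  simp only [lap, fderiv_comp_add_right]
  congr 1
  ext x
  congr 2
  ext j
  rw [← fderiv_comp_add_right (f := fun z => fderiv ℝ φ z (EuclideanSpace.single j 1)) y]

lemma lintegral_potential_rpow_le (ν : Measure E2) [IsFiniteMeasure ν] {S : Set E2}
    {k : E2 → E2 → ℝ≥0∞} (hk : Measurable (Function.uncurry k)) {q : ℝ} (hq : 1 ≤ q) {C : ℝ≥0∞}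
    (hC : ∀ᵐ y ∂ν, ∫⁻ x in S, k x y ^ q ≤ C) :
    ∫⁻ x in S, (∫⁻ y, k x y ∂ν) ^ q ≤ C * ν univ ^ q := by
  have hq0 : 0 < q := by linarith
  have hholder : ∀ x, (∫⁻ y, k x y ∂ν) ^ q ≤ (∫⁻ y, k x y ^ q ∂ν) * ν univ ^ (q - 1) := fun x => by
    have hx : Measurable (k x) := hk.comp measurable_prodMk_left
    have h := eLpNorm'_le_eLpNorm'_mul_rpow_measure_univ one_pos hq
      (hx.aestronglyMeasurable (μ := ν))
    simp only [eLpNorm', enorm_eq_self, ENNReal.rpow_one, div_one] at h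
    calc _ ≤ ((∫⁻ y, k x y ^ q ∂ν) ^ (1 / q) * ν univ ^ (1 - 1 / q)) ^ q := by gcongr
      _ = _ := by
        rw [ENNReal.mul_rpow_of_nonneg _ _ hq0.le, ← ENNReal.rpow_mul, ← ENNReal.rpow_mul]
        congr 2
        · rw [one_div_mul_cancel hq0.ne', ENNReal.rpow_one]
        · field_simp
  calc ∫⁻ x in S, (∫⁻ y, k x y ∂ν) ^ q
      ≤ ∫⁻ x in S, (∫⁻ y, k x y ^ q ∂ν) * ν univ ^ (q - 1) := lintegral_mono fun x => hholder x
    _ = (∫⁻ x in S, ∫⁻ y, k x y ^ q ∂ν) * ν univ ^ (q - 1) :=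
        lintegral_mul_const' _ _ (ENNReal.rpow_ne_top_of_nonneg (by linarith) (measure_ne_top _ _))
    _ = (∫⁻ y, (∫⁻ x in S, k x y ^ q) ∂ν) * ν univ ^ (q - 1) := by
        rw [lintegral_lintegral_swap]
        exact (hk.pow_const q).aemeasurable
    _ ≤ (∫⁻ _, C ∂ν) * ν univ ^ (q - 1) := by
        gcongr 1
        exact lintegral_mono_ae hC
    _ = C * ν univ ^ q := by
        rw [lintegral_const, mul_assoc]
        congr 1
        rcases eq_or_ne (ν univ) 0 with h | h
        · rw [h, zero_mul, ENNReal.zero_rpow_of_pos hq0]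
        · nth_rw 1 [← ENNReal.rpow_one (ν univ)]
          rw [← ENNReal.rpow_add _ _ h (measure_ne_top _ _)]
          congr 1
          ring

lemma tv_eq (μ : SignedMeasure E2) :
    tv μ = μ.toJordanDecomposition.posPart + μ.toJordanDecomposition.negPart := rfl

instance (μ : SignedMeasure E2) : IsFiniteMeasure (tv μ) := by
  rw [tv_eq]; infer_instance

lemma enorm_sInt_le (μ : SignedMeasure E2) (f : E2 → ℝ) : ‖sInt μ f‖ₑ ≤ ∫⁻ y, ‖f y‖ₑ ∂tv μ := by
  rw [tv_eq, lintegral_add_measure]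
  exact (enorm_sub_le).trans (add_le_add (enorm_integral_le_lintegral_enorm _)
    (enorm_integral_le_lintegral_enorm _))

lemma ae_tv_mem_closedBall {μ : SignedMeasure E2} (hμ : tv μ ((closedBall (0:E2) 1)ᶜ) = 0) :
    ∀ᵐ y ∂tv μ, y ∈ closedBall (0:E2) 1 := hμ

lemma posPart_le_tv (μ : SignedMeasure E2) : μ.toJordanDecomposition.posPart ≤ tv μ := by
  rw [tv_eq]; exact Measure.le_add_right le_rfl

lemma negPart_le_tv (μ : SignedMeasure E2) : μ.toJordanDecomposition.negPart ≤ tv μ := by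
  rw [tv_eq]; exact Measure.le_add_left le_rfl

lemma sInt_const_mul (μ : SignedMeasure E2) (c : ℝ) (f : E2 → ℝ) :
    sInt μ (fun x => c * f x) = c * sInt μ f := by
  simp only [sInt, integral_const_mul, mul_sub]

lemma sInt_congr_ae {μ : SignedMeasure E2} {f g : E2 → ℝ} (h : f =ᵐ[tv μ] g) :
    sInt μ f = sInt μ g := by
  unfold sInt
  rw [integral_congr_ae (h.filter_mono (ae_mono (posPart_le_tv μ))),
    integral_congr_ae (h.filter_mono (ae_mono (negPart_le_tv μ)))]

lemma measurable_sInt (μ : SignedMeasure E2) {k : E2 → E2 → ℝ}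
    (hk : Measurable (Function.uncurry k)) : Measurable fun x => sInt μ (k x) :=
  (hk.stronglyMeasurable.integral_prod_right'
    (ν := μ.toJordanDecomposition.posPart)).measurable.sub
  (hk.stronglyMeasurable.integral_prod_right'
    (ν := μ.toJordanDecomposition.negPart)).measurable

/-- A measurable kernel whose sections are uniformly locally integrable. -/
def LocIntegrableKernel (k : E2 → E2 → ℝ) : Prop :=
  Measurable (Function.uncurry k) ∧ ∀ r : ℝ, 0 < r → ∃ C : ℝ≥0∞, C ≠ ∞ ∧
    ∀ y ∈ closedBall (0 : E2) 1, ∫⁻ x in ball (0 : E2) r, ‖k x y‖ₑ ≤ C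

lemma LocIntegrableKernel.integrable_prod {k : E2 → E2 → ℝ} (hk : LocIntegrableKernel k)
    {ν : Measure E2} [IsFiniteMeasure ν] (hν : ∀ᵐ y ∂ν, y ∈ closedBall (0 : E2) 1) {ψ : E2 → ℝ}
    (hψ : Continuous ψ) (hc : HasCompactSupport ψ) :
    Integrable (fun p : E2 × E2 => k p.1 p.2 * ψ p.1) (volume.prod ν) := by
  obtain ⟨M, hM⟩ := hc.exists_bound_of_continuous hψ
  obtain ⟨r, hr, hsub⟩ := hc.isCompact.isBounded.subset_ball_lt 0 0
  obtain ⟨C, hC, hkC⟩ := hk.2 r hr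
  have hmeas : Measurable fun p : E2 × E2 => k p.1 p.2 * ψ p.1 :=
    hk.1.mul (hψ.measurable.comp measurable_fst)
  refine ⟨hmeas.aestronglyMeasurable, ?_⟩
  unfold HasFiniteIntegral
  rw [lintegral_prod_symm' _ hmeas.enorm]
  calc _ ≤ ∫⁻ _, C * ENNReal.ofReal M ∂ν := by
        refine lintegral_mono_ae ?_
        filter_upwards [hν] with y hy
        calc ∫⁻ x, ‖k x y * ψ x‖ₑ = ∫⁻ x in ball 0 r, ‖k x y * ψ x‖ₑ := by
              rw [← lintegral_indicator measurableSet_ball]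
              congr 1
              ext x
              by_cases hx : x ∈ ball (0:E2) r
              · simp [hx]
              · have : ψ x = 0 := image_eq_zero_of_notMem_tsupport fun h => hx (hsub h)
                simp [hx, this]
          _ ≤ ∫⁻ x in ball 0 r, ‖k x y‖ₑ * ENNReal.ofReal M := by
              refine lintegral_mono fun x => ?_
              rw [enorm_mul]
              gcongr
              rw [← ofReal_norm]
              exact ENNReal.ofReal_le_ofReal (hM x)
          _ ≤ C * ENNReal.ofReal M := by
              rw [lintegral_mul_const' _ _ ENNReal.ofReal_ne_top]
              gcongr
              exact hkC y hy
    _ < ∞ := by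
        rw [lintegral_const]
        exact ENNReal.mul_lt_top (ENNReal.mul_lt_top hC.lt_top ENNReal.ofReal_lt_top)
          (measure_lt_top _ _)

lemma LocIntegrableKernel.integrable_sInt_mul {k : E2 → E2 → ℝ} (hk : LocIntegrableKernel k)
    {μ : SignedMeasure E2} (hμ : tv μ ((closedBall (0:E2) 1)ᶜ) = 0) {ψ : E2 → ℝ}
    (hψ : Continuous ψ) (hc : HasCompactSupport ψ) :
    Integrable (fun x => sInt μ (k x) * ψ x) ∧
      ∫ x, sInt μ (k x) * ψ x = sInt μ (fun y => ∫ x, k x y * ψ x) := by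
  have h : ∀ ν : Measure E2, IsFiniteMeasure ν → ν ≤ tv μ →
      Integrable (fun x => (∫ y, k x y ∂ν) * ψ x) ∧
      ∫ x, (∫ y, k x y ∂ν) * ψ x = ∫ y, (∫ x, k x y * ψ x) ∂ν := fun ν _ hle => by
    have hi := hk.integrable_prod ((ae_tv_mem_closedBall hμ).filter_mono (ae_mono hle)) hψ hc
    refine ⟨by simpa only [integral_mul_const] using hi.integral_prod_left, ?_⟩
    simp_rw [← integral_mul_const]
    exact integral_integral_swap hi
  have hp := h _ inferInstance (posPart_le_tv μ)
  have hn := h _ inferInstance (negPart_le_tv μ)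
  unfold sInt
  simp_rw [sub_mul]
  exact ⟨hp.1.sub hn.1, by rw [integral_sub hp.1 hn.1, hp.2, hn.2]⟩

lemma measurable_log_norm_sub : Measurable (Function.uncurry fun x y : E2 => Real.log ‖x - y‖) :=
  Real.measurable_log.comp (measurable_fst.sub measurable_snd).norm

lemma locIntegrableKernel_log : LocIntegrableKernel fun x y => Real.log ‖x - y‖ := by
  refine ⟨measurable_log_norm_sub, fun r hr => ?_⟩
  have := lintegral_abs_log_rpow_ball_le (q := 1) (by norm_num) (by norm_num) hr
  simpa [Real.rpow_one, Real.enorm_eq_ofReal_abs] using this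

lemma measurable_regGrad_sub (i : Fin 2) :
    Measurable (Function.uncurry fun x y : E2 => regGrad 0 i (x - y)) := by
  have : Measurable (regGrad 0 i) := by
    unfold regGrad
    have : Continuous fun x : E2 => x i := by fun_prop
    exact this.measurable.div ((measurable_norm.pow_const 2).add measurable_const)
  exact this.comp (measurable_fst.sub measurable_snd)

lemma enorm_regGrad_le (i : Fin 2) (x : E2) : ‖regGrad 0 i x‖ₑ ≤ ENNReal.ofReal ‖x‖⁻¹ := by
  rw [Real.enorm_eq_ofReal_abs]
  exact ENNReal.ofReal_le_ofReal (abs_regGrad_le 0 i x)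

lemma locIntegrableKernel_regGrad (i : Fin 2) :
    LocIntegrableKernel fun x y => regGrad 0 i (x - y) := by
  refine ⟨measurable_regGrad_sub i, fun r hr => ⟨ENNReal.ofReal
    ((2 * Real.pi / (2 - 1) + Real.pi) * r ^ ((2:ℝ) - 1)), ENNReal.ofReal_ne_top, fun y _ => ?_⟩⟩
  refine (lintegral_mono fun x => ?_).trans
    (lintegral_inv_norm_sub_rpow_ball_le (q := 1) (by norm_num) (by norm_num) 0 y hr)
  rw [Real.rpow_one]
  exact enorm_regGrad_le i _

/-- The logarithmic potential of a signed measure. -/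
def logPot (μ : SignedMeasure E2) (x : E2) : ℝ :=
  -(1 / (2 * Real.pi)) * sInt μ (fun y => Real.log ‖x - y‖)

/-- The pointwise gradient of the logarithmic potential. -/
def gradPot (μ : SignedMeasure E2) (x : E2) : E2 :=
  WithLp.toLp 2 fun i => -(1 / (2 * Real.pi)) * sInt μ (fun y => regGrad 0 i (x - y))

lemma gradPot_apply (μ : SignedMeasure E2) (x : E2) (i : Fin 2) :
    gradPot μ x i = -(1 / (2 * Real.pi)) * sInt μ (fun y => regGrad 0 i (x - y)) := rfl

lemma integrable_mul_gradPot {μ : SignedMeasure E2} (hμ : tv μ ((closedBall (0:E2) 1)ᶜ) = 0)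
    {ψ : E2 → ℝ} (hψ : Continuous ψ) (hc : HasCompactSupport ψ) (i : Fin 2) :
    Integrable fun x => ψ x * gradPot μ x i := by
  have := ((locIntegrableKernel_regGrad i).integrable_sInt_mul hμ hψ hc).1.const_mul
    (-(1 / (2 * Real.pi)))
  refine this.congr (ae_of_all _ fun x => ?_)
  simp only [gradPot_apply]
  ring

lemma isWeakGrad_gradPot {μ : SignedMeasure E2} (hμ : tv μ ((closedBall (0:E2) 1)ᶜ) = 0) :
    IsWeakGrad univ (logPot μ) (gradPot μ) := by
  intro φ hφ _ i
  have h' := hφ.fderiv_apply (EuclideanSpace.single i 1)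
  have h1 := (locIntegrableKernel_log.integrable_sInt_mul hμ h'.continuous h'.2).2
  have h2 := ((locIntegrableKernel_regGrad i).integrable_sInt_mul hμ hφ.continuous hφ.2).2
  simp_rw [integral_log_norm_sub_mul_fderiv hφ] at h1
  have h3 : sInt μ (fun y => -∫ x, regGrad 0 i (x - y) * φ x)
      = -sInt μ (fun y => ∫ x, regGrad 0 i (x - y) * φ x) := by
    simpa using sInt_const_mul μ (-1) (fun y => ∫ x, regGrad 0 i (x - y) * φ x)
  rw [h3, ← h2] at h1
  simp only [Measure.restrict_univ, logPot, gradPot_apply]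
  have h4 : ∀ x, φ x * (-(1 / (2 * Real.pi)) * sInt μ (fun y => regGrad 0 i (x - y)))
      = -(1 / (2 * Real.pi)) * (sInt μ (fun y => regGrad 0 i (x - y)) * φ x) := fun x => by ring
  simp_rw [mul_assoc (-(1 / (2 * Real.pi))), h4, integral_const_mul]
  rw [h1]
  ring

lemma weakPoisson_logPot {μ : SignedMeasure E2} (hμ : tv μ ((closedBall (0:E2) 1)ᶜ) = 0) :
    WeakPoisson univ (logPot μ) μ := by
  intro φ hφ _
  have h1 := (locIntegrableKernel_log.integrable_sInt_mul hμ hφ.lap.continuous hφ.lap.2).2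
  simp_rw [integral_log_norm_sub_mul_lap hφ] at h1
  rw [sInt_const_mul] at h1
  simp only [Measure.restrict_univ, logPot]
  simp_rw [mul_assoc (-(1 / (2 * Real.pi))), integral_const_mul]
  rw [h1]
  have := Real.pi_pos
  field_simp

lemma enorm_neg_one_div_two_pi_mul_le (a : ℝ) : ‖-(1 / (2 * Real.pi)) * a‖ₑ ≤ ‖a‖ₑ := by
  rw [Real.enorm_eq_ofReal_abs, Real.enorm_eq_ofReal_abs]
  refine ENNReal.ofReal_le_ofReal ?_
  rw [abs_mul, abs_neg, abs_of_nonneg (by positivity)]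
  refine mul_le_of_le_one_left (abs_nonneg _) ?_
  rw [div_le_one (by positivity)]
  linarith [Real.two_le_pi]

lemma enorm_logPot_le (μ : SignedMeasure E2) (x : E2) :
    ‖logPot μ x‖ₑ ≤ ∫⁻ y, ‖Real.log ‖x - y‖‖ₑ ∂tv μ :=
  (enorm_neg_one_div_two_pi_mul_le _).trans (enorm_sInt_le _ _)

lemma enorm_gradPot_le (μ : SignedMeasure E2) (x : E2) :
    ‖gradPot μ x‖ₑ ≤ 2 * ∫⁻ y, ENNReal.ofReal ‖x - y‖⁻¹ ∂tv μ := by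
  have h : ∀ i, ‖gradPot μ x i‖ₑ ≤ ∫⁻ y, ENNReal.ofReal ‖x - y‖⁻¹ ∂tv μ := fun i =>
    (enorm_neg_one_div_two_pi_mul_le _).trans ((enorm_sInt_le _ _).trans
      (lintegral_mono fun y => enorm_regGrad_le i _))
  have h2 : ‖gradPot μ x‖ ≤ |gradPot μ x 0| + |gradPot μ x 1| := by
    rw [EuclideanSpace.norm_eq, Real.sqrt_le_left (by positivity)]
    simp only [Fin.sum_univ_two, Real.norm_eq_abs]
    nlinarith [abs_nonneg (gradPot μ x 0), abs_nonneg (gradPot μ x 1)]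
  rw [← ofReal_norm]
  refine (ENNReal.ofReal_le_ofReal h2).trans ?_
  rw [ENNReal.ofReal_add (abs_nonneg _) (abs_nonneg _), ← Real.enorm_eq_ofReal_abs,
    ← Real.enorm_eq_ofReal_abs, two_mul]
  exact add_le_add (h 0) (h 1)

lemma measurable_gradPot (μ : SignedMeasure E2) : Measurable (gradPot μ) := by
  refine (WithLp.measurable_toLp 2 _).comp (measurable_pi_lambda _ fun i => ?_)
  exact (measurable_sInt μ (measurable_regGrad_sub i)).const_mul _

lemma measurable_logPot (μ : SignedMeasure E2) : Measurable (logPot μ) :=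
  (measurable_sInt μ measurable_log_norm_sub).const_mul _

lemma lintegral_gradPot_rpow_le (μ : SignedMeasure E2) {q : ℝ} (hq1 : 1 ≤ q) (hq2 : q < 2)
    (x : E2) {r : ℝ} (hr : 0 < r) :
    ∫⁻ z in ball x r, ‖gradPot μ z‖ₑ ^ q ≤
      2 ^ q * (ENNReal.ofReal ((2 * Real.pi / (2 - q) + Real.pi) * r ^ (2 - q)) *
        tv μ univ ^ q) := by
  have hq0 : 0 ≤ q := by linarith
  have h := lintegral_potential_rpow_le (tv μ) (S := ball x r)
    (k := fun z y => ENNReal.ofReal ‖z - y‖⁻¹)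
    ((measurable_fst.sub measurable_snd).norm.inv.ennreal_ofReal) hq1
    (C := ENNReal.ofReal ((2 * Real.pi / (2 - q) + Real.pi) * r ^ (2 - q)))
    (ae_of_all _ fun y => by
      simp_rw [ENNReal.ofReal_rpow_of_nonneg (inv_nonneg.2 (norm_nonneg _)) hq0]
      exact lintegral_inv_norm_sub_rpow_ball_le hq0 hq2 x y hr)
  calc _ ≤ ∫⁻ z in ball x r, 2 ^ q * (∫⁻ y, ENNReal.ofReal ‖z - y‖⁻¹ ∂tv μ) ^ q := by
        refine lintegral_mono fun z => ?_
        rw [← ENNReal.mul_rpow_of_nonneg _ _ hq0]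
        exact ENNReal.rpow_le_rpow (enorm_gradPot_le μ z) hq0
    _ ≤ _ := by
        rw [lintegral_const_mul' _ _ (by finiteness)]
        gcongr

lemma integrableOn_logPot_rpow {μ : SignedMeasure E2} (hμ : tv μ ((closedBall (0:E2) 1)ᶜ) = 0)
    {q : ℝ} (hq1 : 1 ≤ q) (hq2 : q < 2) {K : Set E2} (hK : IsCompact K) :
    IntegrableOn (fun x => |logPot μ x| ^ q) K := by
  have hq0 : 0 ≤ q := by linarith
  obtain ⟨r, hr, hsub⟩ := hK.isBounded.subset_ball_lt 0 0
  obtain ⟨C, hC, hkC⟩ := lintegral_abs_log_rpow_ball_le hq0 hq2 hr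
  refine IntegrableOn.mono_set ?_ hsub
  refine ⟨((measurable_logPot μ).abs.pow_const q).aestronglyMeasurable, ?_⟩
  have h := lintegral_potential_rpow_le (tv μ) (S := ball 0 r)
    (k := fun z y => ‖Real.log ‖z - y‖‖ₑ) measurable_log_norm_sub.enorm hq1 (C := C) (by
      filter_upwards [ae_tv_mem_closedBall hμ] with y hy
      simp_rw [Real.enorm_eq_ofReal_abs, ENNReal.ofReal_rpow_of_nonneg (abs_nonneg _) hq0]
      exact hkC y hy)
  refine lt_of_le_of_lt (le_trans (lintegral_mono fun x => ?_) h)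
    (ENNReal.mul_lt_top hC.lt_top (by finiteness))
  rw [Real.enorm_of_nonneg (by positivity), ← ENNReal.ofReal_rpow_of_nonneg (abs_nonneg _) hq0,
    ← Real.enorm_eq_ofReal_abs]
  exact ENNReal.rpow_le_rpow (enorm_logPot_le μ x) hq0

lemma integrableOn_gradPot_rpow (μ : SignedMeasure E2)
    {q : ℝ} (hq1 : 1 ≤ q) (hq2 : q < 2) {K : Set E2} (hK : IsCompact K) :
    IntegrableOn (fun x => ‖gradPot μ x‖ ^ q) K := by
  have hq0 : 0 ≤ q := by linarith
  obtain ⟨r, hr, hsub⟩ := hK.isBounded.subset_ball_lt 0 0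
  refine IntegrableOn.mono_set ?_ hsub
  refine ⟨((measurable_gradPot μ).norm.pow_const q).aestronglyMeasurable, ?_⟩
  refine lt_of_le_of_lt (le_trans (lintegral_mono fun x => ?_)
    (lintegral_gradPot_rpow_le μ hq1 hq2 0 hr)) (by finiteness)
  rw [Real.enorm_of_nonneg (by positivity), ← ENNReal.ofReal_rpow_of_nonneg (norm_nonneg _) hq0,
    ofReal_norm]

lemma fderiv_fderiv_comm {φ : E2 → ℝ} (hφ : IsTest φ) (v w x : E2) :
    fderiv ℝ (fun y => fderiv ℝ φ y v) x w = fderiv ℝ (fun y => fderiv ℝ φ y w) x v := by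
  have hd : DifferentiableAt ℝ (fderiv ℝ φ) x :=
    ((hφ.1.fderiv_right (m := (⊤ : ℕ∞)) (by simp)).differentiable (by simp)).differentiableAt
  have h : ∀ v w, fderiv ℝ (fun y => fderiv ℝ φ y v) x w = fderiv ℝ (fderiv ℝ φ) x w v := by
    intro v w
    rw [fderiv_clm_apply hd (differentiableAt_const v)]
    simp
  rw [h, h]
  exact ((contDiff_infty.1 hφ.1 2).contDiffAt.isSymmSndFDerivAt (by simp)).eq w v

lemma lap_fderiv {φ : E2 → ℝ} (hφ : IsTest φ) (v x : E2) :
    lap (fun y => fderiv ℝ φ y v) x = fderiv ℝ (lap φ) x v := by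
  have hd : ∀ w : E2, Differentiable ℝ (fun y => fderiv ℝ (fun z => fderiv ℝ φ z w) y w) :=
    fun w => ((hφ.fderiv_apply w).fderiv_apply w).1.differentiable (by simp)
  have hlap : lap φ = fun y => ∑ i : Fin 2, fderiv ℝ (fun z => fderiv ℝ φ z
    (EuclideanSpace.single i (1:ℝ))) y (EuclideanSpace.single i (1:ℝ)) := rfl
  rw [hlap, fderiv_fun_sum fun i _ => (hd _).differentiableAt, _root_.sum_apply]
  unfold lap
  refine Finset.sum_congr rfl fun i _ => ?_
  rw [funext (fderiv_fderiv_comm hφ v (EuclideanSpace.single i 1)),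
    fderiv_fderiv_comm (hφ.fderiv_apply _)]

/-- A smooth cutoff equal to one near the closed unit disk. -/
def diskBump : ContDiffBump (0 : E2) := ⟨2, 3, by norm_num, by norm_num⟩

lemma isTest_diskBump_mul {g : E2 → ℝ} (hg : ContDiff ℝ (⊤ : ℕ∞) g) :
    IsTest (fun x => diskBump x * g x) :=
  ⟨diskBump.contDiff.mul hg, diskBump.hasCompactSupport.mul_right⟩

lemma sInt_fderiv_diskBump_mul {μ : SignedMeasure E2}
    (hμ : tv μ ((closedBall (0:E2) 1)ᶜ) = 0) {g : E2 → ℝ} (v : E2) :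
    sInt μ (fun x => fderiv ℝ (fun x => diskBump x * g x) x v)
      = sInt μ (fun x => fderiv ℝ g x v) := by
  refine sInt_congr_ae ?_
  filter_upwards [ae_tv_mem_closedBall hμ] with x hx
  have h : (fun x => diskBump x * g x) =ᶠ[𝓝 x] g := by
    have hx' : x ∈ ball (0 : E2) diskBump.rIn :=
      closedBall_subset_ball (by norm_num [diskBump]) hx
    filter_upwards [diskBump.eventuallyEq_one_of_mem_ball hx'] with z hz
    simp [hz]
  rw [h.fderiv_eq]

lemma hasFDerivAt_inner_left (t x : E2) :
    HasFDerivAt (fun x : E2 => inner ℝ x t) (innerSL ℝ t) x := by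
  have h := (innerSL ℝ t).hasFDerivAt (x := x)
  refine h.congr_of_eventuallyEq (Eventually.of_forall fun z => ?_)
  simp [real_inner_comm]

lemma charFun_eq_integral_cos_add_sin (ν : Measure E2) [IsFiniteMeasure ν] (t : E2) :
    charFun ν t = ((∫ x, Real.cos (inner ℝ x t) ∂ν : ℝ) : ℂ)
      + ((∫ x, Real.sin (inner ℝ x t) ∂ν : ℝ) : ℂ) * Complex.I := by
  have hc : Integrable (fun x : E2 => Real.cos (inner ℝ x t)) ν :=
    Integrable.of_bound (by fun_prop) 1 (ae_of_all _ fun x => Real.abs_cos_le_one _)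
  have hs : Integrable (fun x : E2 => Real.sin (inner ℝ x t)) ν :=
    Integrable.of_bound (by fun_prop) 1 (ae_of_all _ fun x => Real.abs_sin_le_one _)
  rw [charFun_apply, ← integral_complex_ofReal, ← integral_complex_ofReal, ← integral_mul_const,
    ← integral_add hc.ofReal (hs.ofReal.mul_const _)]
  congr 1
  ext x
  rw [Complex.exp_mul_I]
  simp

lemma tv_univ_eq_zero_of_sInt_fderiv_eq_zero {μ : SignedMeasure E2}
    (hμ : tv μ ((closedBall (0:E2) 1)ᶜ) = 0) (i : Fin 2)
    (h : ∀ φ, IsTest φ → sInt μ (fun x => fderiv ℝ φ x (EuclideanSpace.single i 1)) = 0) :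
    tv μ univ = 0 := by
  have key : ∀ {g g' : ℝ → ℝ}, ContDiff ℝ (⊤ : ℕ∞) g → (∀ s, HasDerivAt g (g' s) s) →
      ∀ t : E2, t i ≠ 0 → sInt μ (fun x => g' (inner ℝ x t)) = 0 := by
    intro g g' hg hg' t ht
    have h1 := h _ (isTest_diskBump_mul (g := fun x => g (inner ℝ x t))
      (hg.comp (contDiff_id.inner ℝ contDiff_const)))
    rw [sInt_fderiv_diskBump_mul hμ] at h1
    have h2 : ∀ x : E2, fderiv ℝ (fun x : E2 => g (inner ℝ x t)) x (EuclideanSpace.single i 1)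
        = t i * g' (inner ℝ x t) := fun x => by
      have h3 : HasFDerivAt (fun x : E2 => g (inner ℝ x t)) _ x :=
        (hg' _).comp_hasFDerivAt x (hasFDerivAt_inner_left t x)
      rw [h3.fderiv]
      simp [EuclideanSpace.inner_single_right, mul_comm]
    simp_rw [h2] at h1
    rw [sInt_const_mul] at h1
    exact (mul_eq_zero.1 h1).resolve_left ht
  have hdense : Dense {t : E2 | t i ≠ 0} := by
    have hopen : IsOpenMap (EuclideanSpace.proj i : E2 →L[ℝ] ℝ) :=
      (EuclideanSpace.proj i : E2 →L[ℝ] ℝ).isOpenMap fun s =>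
        ⟨EuclideanSpace.single i s, by simp⟩
    exact (dense_compl_singleton (0:ℝ)).preimage hopen
  have hchar : charFun μ.toJordanDecomposition.posPart
      = charFun μ.toJordanDecomposition.negPart := by
    refine Continuous.ext_on hdense continuous_charFun continuous_charFun fun t ht => ?_
    have hc := key Real.contDiff_sin Real.hasDerivAt_sin t ht
    have hs := key Real.contDiff_cos.neg (fun s => (Real.hasDerivAt_cos s).neg) t ht
    simp only [neg_neg] at hs
    unfold sInt at hc hs
    rw [charFun_eq_integral_cos_add_sin, charFun_eq_integral_cos_add_sin, sub_eq_zero.1 hc,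
      sub_eq_zero.1 hs]
  have heq := Measure.ext_of_charFun hchar
  have hsing := μ.toJordanDecomposition.mutuallySingular
  rw [← heq, Measure.MutuallySingular.self_iff] at hsing
  rw [tv_eq, ← heq, hsing]
  simp

lemma exists_integral_logPot_mul_fderiv_ne_zero {μ : SignedMeasure E2}
    (hμ : tv μ ((closedBall (0:E2) 1)ᶜ) = 0) (hpos : 0 < tv μ univ) (i : Fin 2) :
    ∃ φ, IsTest φ ∧ ∫ x, logPot μ x * fderiv ℝ φ x (EuclideanSpace.single i 1) ≠ 0 := by
  by_contra! hcon
  refine hpos.ne' (tv_univ_eq_zero_of_sInt_fderiv_eq_zero hμ i fun φ hφ => ?_)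
  have h1 := weakPoisson_logPot hμ _ (hφ.fderiv_apply (EuclideanSpace.single i 1)) (subset_univ _)
  simp_rw [Measure.restrict_univ, lap_fderiv hφ] at h1
  rw [hcon _ hφ.lap] at h1
  linarith

/-- A weak gradient of a nonzero logarithmic potential is automatically locally integrable: the
Bochner integral of a non-integrable function is zero, while the distributional derivative of the
potential is a nonzero functional. -/
lemma IsWeakGrad.integrable_mul {μ : SignedMeasure E2}
    (hμ : tv μ ((closedBall (0:E2) 1)ᶜ) = 0) (hpos : 0 < tv μ univ) {dI : E2 → E2}
    (h : IsWeakGrad univ (logPot μ) dI) {φ : E2 → ℝ} (hφ : IsTest φ) (i : Fin 2) :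
    Integrable fun x => φ x * dI x i := by
  have hne : ∀ ψ, IsTest ψ → ∫ x, logPot μ x * fderiv ℝ ψ x (EuclideanSpace.single i 1) ≠ 0 →
      Integrable fun x => ψ x * dI x i := fun ψ hψ hψ0 => by
    by_contra hcon
    have := h ψ hψ (subset_univ _) i
    simp only [Measure.restrict_univ] at this
    rw [integral_undef hcon, neg_zero] at this
    exact hψ0 this
  by_cases h0 : ∫ x, logPot μ x * fderiv ℝ φ x (EuclideanSpace.single i 1) = 0
  · obtain ⟨ψ, hψ, hψ0⟩ := exists_integral_logPot_mul_fderiv_ne_zero hμ hpos i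
    have hint : ∀ ψ : E2 → ℝ, IsTest ψ → Integrable fun x =>
        logPot μ x * fderiv ℝ ψ x (EuclideanSpace.single i 1) := fun ψ hψ => by
      have h' := hψ.fderiv_apply (EuclideanSpace.single i 1)
      have := (locIntegrableKernel_log.integrable_sInt_mul hμ h'.continuous h'.2).1.const_mul
        (-(1 / (2 * Real.pi)))
      simpa only [logPot, mul_assoc] using this
    have hsum : ∫ x, logPot μ x *
        fderiv ℝ (fun x => φ x + ψ x) x (EuclideanSpace.single i 1) ≠ 0 := by
      have hfd : ∀ x, logPot μ x * fderiv ℝ (fun x => φ x + ψ x) x (EuclideanSpace.single i 1)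
          = logPot μ x * fderiv ℝ φ x (EuclideanSpace.single i 1)
            + logPot μ x * fderiv ℝ ψ x (EuclideanSpace.single i 1) := fun x => by
        rw [fderiv_fun_add (hφ.1.differentiable (by simp)).differentiableAt
          (hψ.1.differentiable (by simp)).differentiableAt]
        simp [mul_add]
      simp_rw [hfd]
      rwa [integral_add (hint φ hφ) (hint ψ hψ), h0, zero_add]
    refine ((hne _ (hφ.add hψ) hsum).sub (hne ψ hψ hψ0)).congr (ae_of_all _ fun x => ?_)
    simp only [Pi.sub_apply]
    ring
  · exact hne φ hφ h0

lemma locallyIntegrable_of_integrable_isTest_mul {f : E2 → ℝ}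
    (h : ∀ φ, IsTest φ → Integrable fun x => φ x * f x) : LocallyIntegrable f := by
  intro x
  let χ : ContDiffBump x := ⟨1, 2, by norm_num, by norm_num⟩
  refine ⟨ball x 1, ball_mem_nhds x one_pos, ?_⟩
  refine (h χ ⟨χ.contDiff, χ.hasCompactSupport⟩).integrableOn.congr_fun (fun z hz => ?_)
    measurableSet_ball
  have : χ z = 1 := χ.one_of_mem_closedBall (ball_subset_closedBall hz)
  simp [this]

lemma IsWeakGrad.ae_eq_gradPot {μ : SignedMeasure E2}
    (hμ : tv μ ((closedBall (0:E2) 1)ᶜ) = 0) (hpos : 0 < tv μ univ) {dI : E2 → E2}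
    (h : IsWeakGrad univ (logPot μ) dI) : dI =ᵐ[volume] gradPot μ := by
  have hcomp : ∀ i, ∀ᵐ x, dI x i = gradPot μ x i := fun i => by
    refine ae_eq_of_integral_contDiff_smul_eq
      (locallyIntegrable_of_integrable_isTest_mul fun φ hφ => h.integrable_mul hμ hpos hφ i)
      (locallyIntegrable_of_integrable_isTest_mul fun φ hφ =>
        integrable_mul_gradPot hμ hφ.continuous hφ.2 i) fun φ hφ hc => ?_
    have h1 := h φ ⟨hφ, hc⟩ (subset_univ _) i
    have h2 := isWeakGrad_gradPot hμ φ ⟨hφ, hc⟩ (subset_univ _) i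
    simp only [Measure.restrict_univ] at h1 h2
    simp only [smul_eq_mul]
    linarith
  filter_upwards [ae_all_iff.2 hcomp] with x hx
  exact PiLp.ext hx

/-- **Proposition 2.2 (Brezis–Merle), regularity part.** The logarithmic potential of a
signed measure supported in the closed unit disk lies in `W^{1,q}_loc` for all `q ∈ [1,2)`,
weakly solves `-Δ I_μ = μ`, and its gradient satisfies the scale-invariant `L^q` estimate. -/
theorem log_potential_W1q_and_estimate :
    (∀ (μ : SignedMeasure E2),
      tv μ ((closedBall (0:E2) 1)ᶜ) = 0 → 0 < tv μ Set.univ →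
      ∀ I : E2 → ℝ,
        (∀ x, I x = -(1 / (2 * Real.pi)) * sInt μ (fun y => Real.log ‖x - y‖)) →
        ∃ dI : E2 → E2,
          IsWeakGrad Set.univ I dI ∧
          WeakPoisson Set.univ I μ ∧
          (∀ q ∈ Set.Ico (1:ℝ) 2, ∀ K : Set E2, IsCompact K →
            IntegrableOn (fun x => |I x| ^ q) K volume ∧
            IntegrableOn (fun x => ‖dI x‖ ^ q) K volume)) ∧
    (∀ q ∈ Set.Ico (1:ℝ) 2, ∃ C : ℝ, 0 < C ∧
      ∀ (μ : SignedMeasure E2),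
        tv μ ((closedBall (0:E2) 1)ᶜ) = 0 → 0 < tv μ Set.univ →
        ∀ (I : E2 → ℝ) (dI : E2 → E2),
          (∀ x, I x = -(1 / (2 * Real.pi)) * sInt μ (fun y => Real.log ‖x - y‖)) →
          IsWeakGrad Set.univ I dI →
          ∀ (x : E2) (r : ℝ), 0 < r →
            r ^ (q - 2) * (∫ y in ball x r, ‖dI y‖ ^ q)
              ≤ C * ((tv μ Set.univ).toReal) ^ q) := by
  refine ⟨fun μ hμ _ I hI => ?_, fun q hq => ?_⟩
  · obtain rfl : I = logPot μ := funext hI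
    exact ⟨gradPot μ, isWeakGrad_gradPot hμ, weakPoisson_logPot hμ, fun q hq K hK =>
      ⟨integrableOn_logPot_rpow hμ hq.1 hq.2 hK, integrableOn_gradPot_rpow μ hq.1 hq.2 hK⟩⟩
  have hq0 : 0 ≤ q := zero_le_one.trans hq.1
  have hq2 : 0 < 2 - q := sub_pos.2 hq.2
  have hpi := Real.pi_pos
  refine ⟨2 ^ q * (2 * Real.pi / (2 - q) + Real.pi), by positivity, ?_⟩
  intro μ hμ hpos I dI hI hdI x r hr
  obtain rfl : I = logPot μ := funext hI
  have hae : (fun y => ‖dI y‖ ^ q) =ᵐ[volume.restrict (ball x r)] fun y => ‖gradPot μ y‖ ^ q := by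
    filter_upwards [ae_restrict_of_ae (hdI.ae_eq_gradPot hμ hpos)] with y hy
    rw [hy]
  have hint : ∫ y in ball x r, ‖dI y‖ ^ q ≤ 2 ^ q *
      (((2 * Real.pi / (2 - q) + Real.pi) * r ^ (2 - q)) * (tv μ univ).toReal ^ q) := by
    rw [integral_congr_ae hae, integral_eq_lintegral_of_nonneg_ae
      (ae_of_all _ fun y => by positivity)
      ((measurable_gradPot μ).norm.pow_const q).aestronglyMeasurable]
    have h := lintegral_gradPot_rpow_le μ hq.1 hq.2 x hr
    have h' := ENNReal.toReal_mono (by finiteness) h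
    rw [ENNReal.toReal_mul, ENNReal.toReal_mul, ENNReal.toReal_ofReal (by positivity),
      ← ENNReal.toReal_rpow, ← ENNReal.toReal_rpow, ENNReal.toReal_ofNat] at h'
    refine le_of_eq_of_le ?_ h'
    congr 1
    refine lintegral_congr fun y => ?_
    rw [← ENNReal.ofReal_rpow_of_nonneg (norm_nonneg _) hq0, ofReal_norm]
  calc _ ≤ r ^ (q - 2) * (2 ^ q *
      (((2 * Real.pi / (2 - q) + Real.pi) * r ^ (2 - q)) * (tv μ univ).toReal ^ q)) := by gcongr
    _ = (r ^ (q - 2) * r ^ (2 - q)) * (2 ^ q * (2 * Real.pi / (2 - q) + Real.pi) *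
        (tv μ univ).toReal ^ q) := by ring
    _ = _ := by
      rw [← Real.rpow_add hr]
      simp
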